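/- Let M = (M_j)_{j≥0} be a strongly regular sequence and let γ be a real number with 0 < γ < γ(M) and γ < 2. Then there exists a constant d ≥ 1, depending only on M and γ, such that for every real σ > 0 there is a linear continuous (bounded) operator T_{γ,σ} : Λ_{M,σ}(ℕ) → A_{M,dσ}(S_γ) satisfying B(T_{γ,σ} λ) = λ for every λ ∈ Λ_{M,σ}(ℕ); that is, each T_{γ,σ}λ is holomorphic on S_γ with |(T_{γ,σ}λ)^{(j)}(z)| ≤ C (dσ)^j j! M_j for all j and z, and its j-th derivative has limit λ_j at the origin along S_γ. -/

import Mathlib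

noncomputable section

open Filter MeasureTheory
open scoped Topology

def StronglyRegularWith (M : ℕ → ℝ) (A : ℝ) : Prop :=
  (∀ j, 0 < M j) ∧ M 0 = 1 ∧ Monotone M ∧
  (∀ j : ℕ, M (j + 1) * M (j + 1) ≤ M j * M (j + 2)) ∧
  1 ≤ A ∧
  (∀ j k : ℕ, M (j + k) ≤ A ^ (j + k) * (M j * M k)) ∧
  (∀ ℓ N : ℕ, ∑ j ∈ Finset.range N,
      M (ℓ + j) / (((ℓ + j : ℕ) + 1 : ℝ) * M (ℓ + j + 1)) ≤ A * (M ℓ / M (ℓ + 1)))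

def StronglyRegular (M : ℕ → ℝ) : Prop := ∃ A : ℝ, StronglyRegularWith M A

noncomputable def hfn (M : ℕ → ℝ) (t : ℝ) : ℝ :=
  if t = 0 then 0 else ⨅ j : ℕ, t ^ j * M j

def PropertyP (M : ℕ → ℝ) (γ : ℝ) : Prop :=
  ∃ (m' : ℕ → ℝ) (a : ℝ), 1 ≤ a ∧ (∀ j, 0 < m' j) ∧
    (Monotone fun j : ℕ => ((j : ℝ) + 1) ^ (-γ) * m' j) ∧
    (∀ j : ℕ, a⁻¹ * (M (j + 1) / M j) ≤ m' j ∧ m' j ≤ a * (M (j + 1) / M j))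

noncomputable def growthIndex (M : ℕ → ℝ) : ℝ :=
  sSup {γ : ℝ | 0 < γ ∧ PropertyP M γ}

def Sector (γ : ℝ) : Set ℂ :=
  {z : ℂ | z ≠ 0 ∧ |Complex.arg z| < γ * Real.pi / 2}

noncomputable def mixedPartial {n : ℕ} {F : Type*} [NormedAddCommGroup F] [NormedSpace ℝ F]
    (S : Set (EuclideanSpace ℝ (Fin n))) (f : EuclideanSpace ℝ (Fin n) → F)
    (k : ℕ) (e : Fin k → Fin n) (x : EuclideanSpace ℝ (Fin n)) : F :=
  iteratedFDerivWithin ℝ k f S x fun i => EuclideanSpace.single (e i) 1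

/-- Membership in the Banach space `Λ_{M,σ}(ℕ)`. -/
def InLambda (M : ℕ → ℝ) (σ : ℝ) (lam : ℕ → ℂ) : Prop :=
  ∃ C : ℝ, ∀ j : ℕ, ‖lam j‖ ≤ C * σ ^ j * (Nat.factorial j : ℝ) * M j

theorem Sector.mem_slitPlane {γ : ℝ} (hγ : γ ≤ 2) {z : ℂ} (hz : z ∈ Sector γ) :
    z ∈ Complex.slitPlane := by
  rw [Complex.mem_slitPlane_iff_arg]
  refine ⟨fun h => ?_, hz.1⟩
  have h2 := hz.2
  rw [h, abs_of_pos Real.pi_pos] at h2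
  nlinarith [Real.pi_pos]

theorem Sector.isOpen {γ : ℝ} (hγ : γ ≤ 2) : IsOpen (Sector γ) := by
  have h1 : ContinuousOn (fun z : ℂ => |Complex.arg z|) Complex.slitPlane := fun z hz =>
    (Complex.continuousAt_arg hz).abs.continuousWithinAt
  have h2 := h1.isOpen_inter_preimage Complex.isOpen_slitPlane
    (isOpen_Iio (a := γ * Real.pi / 2))
  convert h2 using 1
  ext z
  exact ⟨fun hz => ⟨Sector.mem_slitPlane hγ hz, hz.2⟩,
    fun hz => ⟨Complex.slitPlane_ne_zero hz.1, hz.2⟩⟩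

theorem Sector.mono {γ γ₁ : ℝ} (h : γ ≤ γ₁) : Sector γ ⊆ Sector γ₁ := fun z hz =>
  ⟨hz.1, hz.2.trans_le (by have := Real.pi_pos; gcongr)⟩

theorem Sector.ofReal_mul_mem {γ : ℝ} {t : ℝ} (ht : 0 < t) {z : ℂ} (hz : z ∈ Sector γ) :
    (t : ℂ) * z ∈ Sector γ :=
  ⟨mul_ne_zero (by exact_mod_cast ht.ne') hz.1, by rw [Complex.arg_real_mul _ ht]; exact hz.2⟩

theorem Sector.ofReal_mem {γ : ℝ} (hγ : 0 < γ) {t : ℝ} (ht : 0 < t) : (t : ℂ) ∈ Sector γ :=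
  ⟨by exact_mod_cast ht.ne', by
    rw [Complex.arg_ofReal_of_nonneg ht.le, abs_zero]; have := Real.pi_pos; positivity⟩

theorem Sector.inv_mem {γ : ℝ} {z : ℂ} (hz : z ∈ Sector γ) : z⁻¹ ∈ Sector γ :=
  ⟨inv_ne_zero hz.1, by rw [Complex.abs_arg_inv]; exact hz.2⟩

theorem Sector.isPreconnected {γ : ℝ} (hγ : γ ≤ 2) : IsPreconnected (Sector γ) := by
  have himg : Sector γ = Complex.exp '' {w : ℂ | |w.im| < γ * Real.pi / 2} := by
    ext z
    constructor
    · intro hz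
      exact ⟨Complex.log z, by simpa [Complex.log_im] using hz.2, Complex.exp_log hz.1⟩
    · rintro ⟨w, hw, rfl⟩
      refine ⟨Complex.exp_ne_zero w, ?_⟩
      have hw' : |w.im| < Real.pi :=
        lt_of_lt_of_le hw (by nlinarith [Real.pi_pos])
      rw [abs_lt] at hw'
      rw [Complex.arg_exp, (toIocMod_eq_self Real.two_pi_pos).2 ⟨hw'.1, by linarith⟩]
      exact hw
  rw [himg]
  refine IsPreconnected.image (Convex.isPreconnected ?_) _ Complex.continuous_exp.continuousOn
  have : {w : ℂ | |w.im| < γ * Real.pi / 2} =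
      Complex.imLm ⁻¹' (Set.Ioo (-(γ * Real.pi / 2)) (γ * Real.pi / 2)) := by
    ext w
    simp [abs_lt]
  rw [this]
  exact (convex_Ioo _ _).linear_preimage _

theorem Sector.exists_closedBall_subset {γ γ₁ : ℝ} (h : γ < γ₁) (hγ₁ : γ₁ ≤ 2) :
    ∃ ε : ℝ, 0 < ε ∧ ε < 1 ∧ ∀ z ∈ Sector γ, Metric.closedBall z (ε * ‖z‖) ⊆ Sector γ₁ := by
  have hc : ∀ᶠ u : ℂ in 𝓝 1, |Complex.arg u| < (γ₁ - γ) * Real.pi / 2 := by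
    have h1 : ContinuousAt (fun u : ℂ => |Complex.arg u|) 1 :=
      (Complex.continuousAt_arg Complex.one_mem_slitPlane).abs
    refine h1.eventually_lt_const ?_
    have := Real.pi_pos
    have : 0 < γ₁ - γ := by linarith
    simp only [Complex.arg_one, abs_zero]
    positivity
  obtain ⟨δ, hδ, hball⟩ := Metric.eventually_nhds_iff.1 hc
  refine ⟨min (δ / 2) (1 / 2), by positivity, by
    have := min_le_right (δ / 2) (1 / 2); linarith, fun z hz v hv => ?_⟩
  set ε := min (δ / 2) (1 / 2)
  have hz0 : 0 < ‖z‖ := norm_pos_iff.2 hz.1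
  have hu : dist (v / z) 1 ≤ ε := by
    rw [Metric.mem_closedBall, dist_eq_norm] at hv
    rw [dist_eq_norm, show v / z - 1 = (v - z) / z by rw [sub_div, div_self hz.1], norm_div,
      div_le_iff₀ hz0]
    exact hv
  have hu1 : dist (v / z) 1 < δ := by
    have := min_le_left (δ / 2) (1 / 2 : ℝ); linarith
  have hu0 : v / z ≠ 0 := by
    intro h0
    rw [h0] at hu
    have := min_le_right (δ / 2) (1 / 2 : ℝ)
    rw [dist_zero_left, norm_one] at hu
    linarith [show (1 : ℝ) ≤ 1 / 2 from hu.trans this]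
  have ha := hball hu1
  have hv : v = z * (v / z) := by rw [mul_div_cancel₀ _ hz.1]
  have hsum : |z.arg + (v / z).arg| < γ₁ * Real.pi / 2 := by
    have := abs_add_le z.arg (v / z).arg
    have := hz.2
    linarith
  have hsum' := abs_lt.1 (lt_of_lt_of_le hsum (show γ₁ * Real.pi / 2 ≤ Real.pi by
    nlinarith [Real.pi_pos]))
  refine ⟨by rw [hv]; exact mul_ne_zero hz.1 hu0, ?_⟩
  rw [hv, Complex.arg_mul hz.1 hu0 ⟨hsum'.1, hsum'.2.le⟩]
  exact hsum

theorem sum_range_rpow_div_le {q : ℝ} (hq : 1 < q) (j n : ℕ) :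
    ∑ i ∈ Finset.range n, (((j : ℝ) + 1) / ((j : ℝ) + i + 1)) ^ q ≤
      (1 + 1 / (q - 1)) * ((j : ℝ) + 1) := by
  set J : ℝ := (j : ℝ) + 1 with hJ
  have hJ1 : 1 ≤ J := by simp [hJ]
  have hq0 : 0 < q - 1 := by linarith
  have step : ∀ y : ℝ, 1 < y → (q - 1) * y ^ (-q) ≤ (y - 1) ^ (1 - q) - y ^ (1 - q) := by
    intro y hy
    have hy0 : 0 < y := by linarith
    have hy1 : 0 < y - 1 := by linarith
    have hx : 0 < (y - 1) / y := by positivity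
    have h1 : (y - 1) ^ (1 - q) = y ^ (1 - q) * ((y - 1) / y) ^ (1 - q) := by
      rw [← Real.mul_rpow hy0.le hx.le, mul_div_cancel₀ _ hy0.ne']
    have h2 : y ^ (-q) = y ^ (1 - q) * (1 / y) := by
      rw [show -q = (1 - q) - 1 by ring, Real.rpow_sub_one hy0.ne']; ring
    have h3 : 1 + (q - 1) * (1 / y) ≤ ((y - 1) / y) ^ (1 - q) := by
      rw [Real.rpow_def_of_pos hx]
      have hl := Real.log_le_sub_one_of_pos hx
      have : (y - 1) / y - 1 = -(1 / y) := by field_simp; ring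
      rw [this] at hl
      have := Real.add_one_le_exp (Real.log ((y - 1) / y) * (1 - q))
      nlinarith
    have hp : 0 < y ^ (1 - q) := Real.rpow_pos_of_pos hy0 _
    rw [h1, h2]
    nlinarith
  have main : ∀ n : ℕ, ∑ i ∈ Finset.range (n + 1), (J / ((j : ℝ) + i + 1)) ^ q ≤
      1 + J / (q - 1) - J ^ q / (q - 1) * (J + n) ^ (1 - q) := by
    intro n
    induction n with
    | zero =>
      have h0 : J ^ q * J ^ (1 - q) = J := by
        rw [← Real.rpow_add (by linarith)]; simp
      have : J / ((j : ℝ) + 1) = 1 := div_self (by positivity)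
      simp only [zero_add, Finset.range_one, Finset.sum_singleton, Nat.cast_zero, add_zero, this,
        Real.one_rpow]
      rw [div_mul_eq_mul_div, h0]; linarith
    | succ n ih =>
      rw [Finset.sum_range_succ]
      have hs := step (J + (n + 1)) (by
        have : (0 : ℝ) ≤ n := Nat.cast_nonneg n
        linarith)
      have hJn : 0 < J + (n + 1 : ℝ) := by positivity
      have h4 : (J / ((j : ℝ) + (n + 1 : ℕ) + 1)) ^ q = J ^ q * (J + (n + 1)) ^ (-q) := by
        rw [Real.rpow_neg hJn.le, ← div_eq_mul_inv, ← Real.div_rpow (by linarith) hJn.le]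
        congr 2
        push_cast; rw [hJ]; ring
      have hJq : 0 < J ^ q / (q - 1) := by positivity
      rw [show J + ((n : ℝ) + 1) - 1 = J + n by ring] at hs
      have h5 := mul_le_mul_of_nonneg_left hs hJq.le
      have h6 : J ^ q / (q - 1) * ((q - 1) * (J + (n + 1)) ^ (-q)) =
          J ^ q * (J + (n + 1)) ^ (-q) := by
        field_simp
      rw [h6] at h5
      rw [h4]
      push_cast
      linarith
  have hfin : ∑ i ∈ Finset.range n, (J / ((j : ℝ) + i + 1)) ^ q ≤
      ∑ i ∈ Finset.range (n + 1), (J / ((j : ℝ) + i + 1)) ^ q :=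
    Finset.sum_le_sum_of_subset_of_nonneg (Finset.range_mono n.le_succ)
      fun i _ _ => by positivity
  have hnn : 0 ≤ J ^ q / (q - 1) * (J + n) ^ (1 - q) := by positivity
  calc _ ≤ _ := hfin
    _ ≤ 1 + J / (q - 1) := by linarith [main n]
    _ ≤ (1 + 1 / (q - 1)) * J := by
      have : (1 + 1 / (q - 1)) * J = J + J / (q - 1) := by ring
      linarith

theorem PropertyP.sum_quotient_rpow_le {M : ℕ → ℝ} (hpos : ∀ j, 0 < M j) {γ s : ℝ}
    (hP : PropertyP M γ) (hs : 0 < s) (hsγ : 1 < s * γ) :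
    ∃ C : ℝ, 0 ≤ C ∧ ∀ j n : ℕ, ∑ i ∈ Finset.range n,
      ((M (j + 1) / M j) / (M (j + i + 1) / M (j + i))) ^ s ≤ C * ((j : ℝ) + 1) := by
  obtain ⟨m', a, ha, hm', hmono, hcmp⟩ := hP
  have ha0 : 0 < a := by linarith
  refine ⟨(a ^ 2) ^ s * (1 + 1 / (s * γ - 1)), ?_, fun j n => ?_⟩
  · have : 0 < s * γ - 1 := by linarith
    positivity
  have key : ∀ i : ℕ, ((M (j + 1) / M j) / (M (j + i + 1) / M (j + i))) ^ s ≤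
      (a ^ 2) ^ s * (((j : ℝ) + 1) / ((j : ℝ) + i + 1)) ^ (s * γ) := by
    intro i
    have hj0 : (0 : ℝ) < (j : ℝ) + 1 := by positivity
    have hi0 : (0 : ℝ) < (j : ℝ) + i + 1 := by positivity
    have hmj : 0 < M (j + 1) / M j := div_pos (hpos _) (hpos _)
    have hmi : 0 < M (j + i + 1) / M (j + i) := div_pos (hpos _) (hpos _)
    have h1 : ((j : ℝ) + 1) ^ (-γ) * m' j ≤ ((j : ℝ) + i + 1) ^ (-γ) * m' (j + i) := by
      simpa using hmono (Nat.le_add_right j i)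
    have h2 : m' j ≤ (((j : ℝ) + 1) / ((j : ℝ) + i + 1)) ^ γ * m' (j + i) := by
      rw [Real.rpow_neg hj0.le, Real.rpow_neg hi0.le, inv_mul_le_iff₀ (by positivity)] at h1
      rw [Real.div_rpow hj0.le hi0.le]
      calc _ ≤ _ := h1
        _ = _ := by ring
    have h3 : (M (j + 1) / M j) / (M (j + i + 1) / M (j + i)) ≤
        a ^ 2 * (((j : ℝ) + 1) / ((j : ℝ) + i + 1)) ^ γ := by
      rw [div_le_iff₀ hmi]
      have h4 := (hcmp j).1
      rw [inv_mul_le_iff₀ ha0] at h4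
      calc _ ≤ a * m' j := h4
        _ ≤ a * ((((j : ℝ) + 1) / ((j : ℝ) + i + 1)) ^ γ * (a * (M (j + i + 1) / M (j + i)))) := by
          have := (hcmp (j + i)).2
          gcongr
          exact h2.trans (by gcongr)
        _ = _ := by ring
    calc _ ≤ (a ^ 2 * (((j : ℝ) + 1) / ((j : ℝ) + i + 1)) ^ γ) ^ s := by gcongr
      _ = _ := by
        rw [Real.mul_rpow (by positivity) (by positivity), ← Real.rpow_mul (by positivity),
          mul_comm γ s]
  calc _ ≤ ∑ i ∈ Finset.range n,
        (a ^ 2) ^ s * (((j : ℝ) + 1) / ((j : ℝ) + i + 1)) ^ (s * γ) :=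
        Finset.sum_le_sum fun i _ => key i
    _ ≤ _ := by
      rw [← Finset.mul_sum, mul_assoc]
      gcongr
      exact sum_range_rpow_div_le hsγ j n

theorem norm_log_one_add_le_of_re_nonneg {x : ℂ} (hx : 0 ≤ x.re) :
    ‖Complex.log (1 + x)‖ ≤ ‖x‖ := by
  have hslit : ∀ y ∈ {y : ℂ | 0 ≤ y.re}, 1 + y ∈ Complex.slitPlane := fun y hy =>
    Or.inl (by
      have hy' : 0 ≤ y.re := hy
      simp only [Complex.add_re, Complex.one_re]
      linarith)
  have hd : ∀ y ∈ {y : ℂ | 0 ≤ y.re},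
      HasDerivAt (fun u : ℂ => Complex.log (1 + u)) (1 / (1 + y)) y := fun y hy =>
    ((hasDerivAt_id y).const_add 1).clog (hslit y hy)
  have h := Convex.norm_image_sub_le_of_norm_deriv_le (𝕜 := ℂ)
    (f := fun u : ℂ => Complex.log (1 + u)) (s := {y : ℂ | 0 ≤ y.re}) (C := 1) (x := 0) (y := x)
    (fun y hy => (hd y hy).differentiableAt) (fun y hy => ?_)
    (convex_halfSpace_re_ge 0) (by simp) hx
  · simpa using h
  · rw [(hd y hy).deriv, norm_div, norm_one]
    have h1 : (1 : ℝ) ≤ ‖1 + y‖ := by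
      have := Complex.re_le_norm (1 + y)
      simp only [Complex.add_re, Complex.one_re] at this
      have hy' : 0 ≤ y.re := hy
      linarith
    exact (div_le_one (by linarith)).2 h1

/-- The series `∑ log (1 + cᵢ u)` attached to a summable sequence `c`. -/
def logSeries (c : ℕ → ℝ) (u : ℂ) : ℂ := ∑' i, Complex.log (1 + u * c i)

theorem summable_logSeries {c : ℕ → ℝ} (hc : ∀ i, 0 ≤ c i) (hsum : Summable c) {u : ℂ}
    (hu : 0 ≤ u.re) : Summable fun i => Complex.log (1 + u * c i) := by
  refine Summable.of_norm_bounded (hsum.mul_left ‖u‖) fun i => ?_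
  refine (norm_log_one_add_le_of_re_nonneg ?_).trans_eq ?_
  · rw [Complex.re_mul_ofReal]; exact mul_nonneg hu (hc i)
  · rw [norm_mul, Complex.norm_real, Real.norm_of_nonneg (hc i)]

theorem differentiableOn_logSeries {c : ℕ → ℝ} (hc : ∀ i, 0 ≤ c i) (hsum : Summable c) :
    DifferentiableOn ℂ (logSeries c) {u : ℂ | 0 < u.re} := by
  intro u₀ hu₀
  set U : Set ℂ := {u : ℂ | 0 < u.re} ∩ Metric.ball 0 (‖u₀‖ + 1)
  have hUo : IsOpen U :=
    (isOpen_lt continuous_const Complex.continuous_re).inter Metric.isOpen_ball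
  have hre : ∀ u ∈ U, ∀ i, 0 ≤ (u * c i).re := fun u hu i => by
    rw [Complex.re_mul_ofReal]
    exact mul_nonneg (le_of_lt hu.1) (hc i)
  have hd : DifferentiableOn ℂ (fun u => ∑' i, Complex.log (1 + u * c i)) U := by
    refine Complex.differentiableOn_tsum_of_summable_norm (hsum.mul_left (‖u₀‖ + 1))
      (fun i u hu => ?_) hUo fun i u hu => ?_
    · refine DifferentiableAt.differentiableWithinAt (DifferentiableAt.clog (by fun_prop) ?_)
      left
      have := hre u hu i
      simp only [Complex.add_re, Complex.one_re]
      linarith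
    · refine (norm_log_one_add_le_of_re_nonneg (hre u hu i)).trans ?_
      rw [norm_mul, Complex.norm_real, Real.norm_of_nonneg (hc i)]
      have := (mem_ball_zero_iff.1 hu.2).le
      have := hc i
      gcongr
  have hmem : u₀ ∈ U := ⟨hu₀, by simp⟩
  exact (hd.differentiableAt (hUo.mem_nhds hmem)).differentiableWithinAt

theorem sum_log_le_re_logSeries {c : ℕ → ℝ} (hc : ∀ i, 0 < c i) (hsum : Summable c) {u : ℂ}
    (hu : 0 ≤ u.re) (hu0 : u ≠ 0) (p : ℕ) :
    ∑ i ∈ Finset.range p, Real.log (‖u‖ * c i) ≤ (logSeries c u).re := by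
  have hs := summable_logSeries (fun i => (hc i).le) hsum hu
  rw [logSeries, Complex.re_tsum hs]
  have hre : ∀ i, 0 ≤ (u * c i).re := fun i => by
    rw [Complex.re_mul_ofReal]
    exact mul_nonneg hu (hc i).le
  calc _ ≤ ∑ i ∈ Finset.range p, (Complex.log (1 + u * c i)).re := by
        refine Finset.sum_le_sum fun i _ => ?_
        have hpos : 0 < ‖u‖ * c i := mul_pos (norm_pos_iff.2 hu0) (hc i)
        rw [Complex.log_re]
        refine Real.log_le_log hpos ?_
        have h1 : ‖u‖ * c i = ‖u * c i‖ := by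
          rw [norm_mul, Complex.norm_real, Real.norm_of_nonneg (hc i).le]
        rw [h1]
        refine le_of_sq_le_sq ?_ (norm_nonneg _)
        rw [← Complex.normSq_eq_norm_sq, ← Complex.normSq_eq_norm_sq, Complex.normSq_add]
        have := mul_nonneg hu (hc i).le
        simp
        nlinarith
    _ ≤ _ := by
      refine Summable.sum_le_tsum _ (fun i _ => ?_) (Complex.reCLM.summable hs)
      rw [Complex.log_re]
      refine Real.log_nonneg ?_
      have := Complex.re_le_norm (1 + u * c i)
      simp only [Complex.add_re, Complex.one_re] at this
      linarith [hre i]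

theorem logSeries_ofReal {c : ℕ → ℝ} (hc : ∀ i, 0 ≤ c i) {x : ℝ} (hx : 0 ≤ x) :
    logSeries c x = ((∑' i, Real.log (1 + x * c i) : ℝ) : ℂ) := by
  rw [logSeries, Complex.ofReal_tsum]
  congr 1
  funext i
  rw [Complex.ofReal_log (by have := mul_nonneg hx (hc i); linarith)]
  push_cast
  rfl

theorem re_cpow_pos_of_mem_Sector {γ : ℝ} (hγ : 0 < γ) {z : ℂ} (hz : z ∈ Sector γ) :
    0 < (z ^ ((1 / γ : ℝ) : ℂ)).re := by
  rw [Complex.cpow_def_of_ne_zero hz.1, Complex.exp_re, Complex.im_mul_ofReal, Complex.log_im]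
  refine mul_pos (Real.exp_pos _) (Real.cos_pos_of_mem_Ioo (abs_lt.1 ?_))
  rw [abs_mul, abs_of_pos (show 0 < 1 / γ by positivity), mul_one_div, div_lt_iff₀ hγ]
  linarith [hz.2]

theorem sum_range_log_quotient {M : ℕ → ℝ} (hpos : ∀ j, 0 < M j) (hM0 : M 0 = 1) (p : ℕ) :
    ∑ i ∈ Finset.range p, Real.log (M (i + 1) / M i) = Real.log (M p) := by
  have : ∀ i, Real.log (M (i + 1) / M i) = Real.log (M (i + 1)) - Real.log (M i) := fun i =>
    Real.log_div (hpos _).ne' (hpos _).ne'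
  simp only [this]
  rw [Finset.sum_range_sub (fun i => Real.log (M i)), hM0, Real.log_one, sub_zero]

/-- A kernel on `Sector γ` which is as flat at infinity as `M` allows and, on the positive axis,
not flatter than that up to a geometric factor. -/
structure FlatKernel (M : ℕ → ℝ) (γ : ℝ) where
  toFun : ℂ → ℂ
  onReal : ℝ → ℝ
  B : ℝ
  one_le_B : 1 ≤ B
  differentiableOn : DifferentiableOn ℂ toFun (Sector γ)
  norm_mul_pow_le : ∀ z ∈ Sector γ, ∀ p : ℕ, ‖toFun z‖ * ‖z‖ ^ p ≤ M p
  toFun_ofReal : ∀ t : ℝ, 0 < t → toFun t = onReal t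
  onReal_pos : ∀ t : ℝ, 0 < t → 0 < onReal t
  le_onReal : ∀ (j : ℕ) (t : ℝ), 0 < t → t ≤ M (j + 1) / M j →
    M j / (M (j + 1) / M j) ^ j ≤ B ^ (j + 1) * onReal t

theorem exists_flatKernel {M : ℕ → ℝ} (hpos : ∀ j, 0 < M j) (hM0 : M 0 = 1)
    (hconv : ∀ j : ℕ, M (j + 1) * M (j + 1) ≤ M j * M (j + 2)) {γ γ' : ℝ} (hγ : 0 < γ)
    (hγ2 : γ ≤ 2) (hγγ' : γ < γ') (hP : PropertyP M γ') : Nonempty (FlatKernel M γ) := by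
  set s : ℝ := 1 / γ with hs_def
  have hs : 0 < s := by positivity
  have hsγ : s * γ = 1 := by rw [hs_def]; field_simp
  obtain ⟨C, hC, hsum⟩ := hP.sum_quotient_rpow_le hpos hs (by nlinarith)
  set m : ℕ → ℝ := fun i => M (i + 1) / M i with hm_def
  have hm : ∀ i, 0 < m i := fun i => div_pos (hpos _) (hpos _)
  have hmono : Monotone m := monotone_nat_of_le_succ fun i => by
    rw [hm_def]
    simp only
    rw [div_le_div_iff₀ (hpos _) (hpos _)]
    linarith [hconv i]
  set c : ℕ → ℝ := fun i => m i ^ (-s) with hc_def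
  have hc : ∀ i, 0 < c i := fun i => Real.rpow_pos_of_pos (hm i) _
  have hratio : ∀ t : ℝ, 0 ≤ t → ∀ i, t ^ s * c i = (t / m i) ^ s := fun t ht i => by
    rw [hc_def]
    simp only
    rw [Real.rpow_neg (hm i).le, Real.div_rpow ht (hm i).le, div_eq_mul_inv]
  have hcs : Summable c := by
    have h0 : 0 < m 0 ^ s := Real.rpow_pos_of_pos (hm 0) _
    have h1 : Summable fun i => m 0 ^ s * c i := by
      refine summable_of_sum_range_le (c := C * (((0 : ℕ) : ℝ) + 1))
        (fun i => (mul_pos h0 (hc i)).le) fun n => ?_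
      refine le_trans (le_of_eq (Finset.sum_congr rfl fun i _ => ?_)) (hsum 0 n)
      rw [hratio _ (hm 0).le i]
      simp [hm_def]
    exact (summable_mul_left_iff h0.ne').1 h1
  have hlogsum : ∀ t : ℝ, 0 < t → ∀ i, 0 ≤ Real.log (1 + t ^ s * c i) := fun t ht i => by
    have h1 : 0 < t ^ s := Real.rpow_pos_of_pos ht _
    have h2 := mul_pos h1 (hc i)
    exact Real.log_nonneg (by linarith)
  refine ⟨⟨fun z => Complex.exp (-((1 / s : ℝ) : ℂ) * logSeries c (z ^ (s : ℂ))),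
    fun t => Real.exp (-(1 / s) * ∑' i, Real.log (1 + t ^ s * c i)),
    Real.exp ((Real.log 2 + C) / s), ?_, ?_, ?_, ?_, fun t _ => Real.exp_pos _, ?_⟩⟩
  · have := Real.log_nonneg (show (1 : ℝ) ≤ 2 by norm_num)
    exact Real.one_le_exp (by positivity)
  · refine DifferentiableOn.cexp (DifferentiableOn.const_mul ?_ _)
    refine (differentiableOn_logSeries (fun i => (hc i).le) hcs).comp (fun z hz => ?_)
      fun z hz => re_cpow_pos_of_mem_Sector hγ hz
    exact (differentiableAt_id.cpow_const (Sector.mem_slitPlane hγ2 hz)).differentiableWithinAt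
  · intro z hz p
    have hz0 : 0 < ‖z‖ := norm_pos_iff.2 hz.1
    have hre := re_cpow_pos_of_mem_Sector hγ hz
    have h1 := sum_log_le_re_logSeries hc hcs hre.le
      (fun h => by rw [h] at hre; simp at hre) p
    rw [Complex.norm_exp, neg_mul, Complex.neg_re, Complex.re_ofReal_mul]
    have h2 : ∑ i ∈ Finset.range p, Real.log (‖z ^ (s : ℂ)‖ * c i) =
        s * (p * Real.log ‖z‖ - Real.log (M p)) := by
      rw [← sum_range_log_quotient hpos hM0 p, mul_sub, Finset.mul_sum]
      have : ∀ i, Real.log (‖z ^ (s : ℂ)‖ * c i) =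
          s * Real.log ‖z‖ - s * Real.log (M (i + 1) / M i) := fun i => by
        rw [Complex.norm_cpow_real, hratio _ hz0.le, Real.log_rpow (div_pos hz0 (hm i)),
          Real.log_div hz0.ne' (hm i).ne']
        ring
      simp only [this, Finset.sum_sub_distrib, Finset.sum_const, Finset.card_range, nsmul_eq_mul]
      ring
    rw [h2] at h1
    have h3 : -(1 / s * (logSeries c (z ^ (s : ℂ))).re) ≤ Real.log (M p) - p * Real.log ‖z‖ := by
      have : 1 / s * (s * (p * Real.log ‖z‖ - Real.log (M p))) ≤
          1 / s * (logSeries c (z ^ (s : ℂ))).re := by gcongr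
      rw [← mul_assoc, one_div_mul_cancel hs.ne', one_mul] at this
      linarith
    calc _ ≤ Real.exp (Real.log (M p) - p * Real.log ‖z‖) * ‖z‖ ^ p := by gcongr
      _ = M p := by
        rw [Real.exp_sub, Real.exp_log (hpos p), mul_comm (p : ℝ), Real.exp_mul,
          Real.exp_log hz0, Real.rpow_natCast, div_mul_cancel₀ _ (by positivity)]
  · intro t ht
    have hts : ((t : ℂ) ^ (s : ℂ)) = ((t ^ s : ℝ) : ℂ) := (Complex.ofReal_cpow ht.le s).symm
    rw [hts, logSeries_ofReal (fun i => (hc i).le) (Real.rpow_nonneg ht.le _)]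
    push_cast
    rfl
  · intro j t ht htj
    have hle : ∑' i, Real.log (1 + t ^ s * c i) ≤
        (Real.log 2 + C) * (j + 1) + s * (j * Real.log (m j) - Real.log (M j)) := by
      refine Real.tsum_le_of_sum_range_le (hlogsum t ht) fun n => ?_
      have h1 : ∑ i ∈ Finset.range n, Real.log (1 + t ^ s * c i) ≤
          ∑ i ∈ Finset.range (j + n), Real.log (1 + t ^ s * c i) :=
        Finset.sum_le_sum_of_subset_of_nonneg (Finset.range_mono (by omega))
          fun i _ _ => hlogsum t ht i
      have h2 : ∑ i ∈ Finset.range j, Real.log (1 + t ^ s * c i) ≤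
          j * Real.log 2 + s * (j * Real.log (m j) - Real.log (M j)) := by
        have : ∀ i ∈ Finset.range j, Real.log (1 + t ^ s * c i) ≤
            (Real.log 2 + s * Real.log (m j)) - s * Real.log (M (i + 1) / M i) := fun i hi => by
          have hij : m i ≤ m j := hmono (Finset.mem_range.1 hi).le
          have hx1 : 1 ≤ (m j / m i) ^ s :=
            Real.one_le_rpow ((one_le_div (hm i)).2 hij) hs.le
          have hx2 : (t / m i) ^ s ≤ (m j / m i) ^ s := by
            have := hm i
            gcongr
          have : Real.log (1 + t ^ s * c i) ≤ Real.log (2 * (m j / m i) ^ s) := by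
            refine Real.log_le_log ?_ ?_
            · have := mul_pos (Real.rpow_pos_of_pos ht s) (hc i)
              linarith
            · rw [hratio t ht.le]; linarith
          rw [Real.log_mul (by norm_num) (by positivity), Real.log_rpow (div_pos (hm j) (hm i)),
            Real.log_div (hm j).ne' (hm i).ne'] at this
          change _ ≤ _ - s * Real.log (m i)
          linarith
        refine (Finset.sum_le_sum this).trans_eq ?_
        rw [Finset.sum_sub_distrib, ← Finset.mul_sum, sum_range_log_quotient hpos hM0]
        simp only [Finset.sum_const, Finset.card_range, nsmul_eq_mul]
        ring
      have h3 : ∑ i ∈ Finset.range n, Real.log (1 + t ^ s * c (j + i)) ≤ C * (j + 1) := by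
        refine (Finset.sum_le_sum fun i _ => ?_).trans (hsum j n)
        have hx2 : (t / m (j + i)) ^ s ≤
            ((M (j + 1) / M j) / (M (j + i + 1) / M (j + i))) ^ s :=
          Real.rpow_le_rpow (div_nonneg ht.le (hm _).le)
            (div_le_div_of_nonneg_right htj (hm (j + i)).le) hs.le
        have h4 := mul_pos (Real.rpow_pos_of_pos ht s) (hc (j + i))
        have h5 := Real.log_le_sub_one_of_pos (show 0 < 1 + t ^ s * c (j + i) by linarith)
        rw [hratio t ht.le] at h5 ⊢
        exact h5.trans (by linarith)
      rw [Finset.sum_range_add] at h1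
      have := Real.log_nonneg (show (1 : ℝ) ≤ 2 by norm_num)
      linarith
    have h6 : Real.log (M j) - j * Real.log (m j) ≤
        (Real.log 2 + C) / s * (j + 1) + -(1 / s) * ∑' i, Real.log (1 + t ^ s * c i) := by
      have h7 := mul_le_mul_of_nonneg_left hle (show 0 ≤ 1 / s by positivity)
      have h8 : 1 / s * ((Real.log 2 + C) * (j + 1) + s * (j * Real.log (m j) - Real.log (M j)))
          = (Real.log 2 + C) / s * (j + 1) + (j * Real.log (m j) - Real.log (M j)) := by
        field_simp
      linarith
    calc M j / m j ^ j = Real.exp (Real.log (M j) - j * Real.log (m j)) := by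
          rw [Real.exp_sub, Real.exp_log (hpos j), mul_comm (j : ℝ), Real.exp_mul,
            Real.exp_log (hm j), Real.rpow_natCast]
      _ ≤ _ := Real.exp_le_exp.2 h6
      _ = _ := by
        rw [Real.exp_add, Real.exp_mul]
        congr 1
        exact_mod_cast Real.rpow_natCast _ (j + 1)

theorem differentiableOn_integral_scaled {γ : ℝ} (hγ : γ ≤ 2) {G : ℂ → ℂ}
    (hG : DifferentiableOn ℂ G (Sector γ)) {I : Set ℝ} (hI : I ⊆ Set.Ioi 0)
    (hIm : MeasurableSet I)
    (hbound : ∀ w₀ ∈ Sector γ, ∃ U ∈ 𝓝 w₀, ∃ bound : ℝ → ℝ, IntegrableOn bound I ∧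
      ∀ t ∈ I, ∀ w ∈ U, ‖(t : ℂ)⁻¹ * G (t * w)‖ ≤ bound t) :
    DifferentiableOn ℂ (fun w => ∫ t in I, (t : ℂ)⁻¹ * G (t * w)) (Sector γ) := by
  have hSo := Sector.isOpen hγ
  intro w₀ hw₀
  obtain ⟨U, hU, bound, hbi, hb⟩ := hbound w₀ hw₀
  obtain ⟨δ, hδ, hball⟩ := Metric.mem_nhds_iff.1 (Filter.inter_mem hU (hSo.mem_nhds hw₀))
  have hmap : ∀ w ∈ Sector γ, Set.MapsTo (fun t : ℝ => (t : ℂ) * w) I (Sector γ) :=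
    fun w hw t ht => Sector.ofReal_mul_mem (hI ht) hw
  have hcl : ∀ w : ℂ, ContinuousOn (fun t : ℝ => (t : ℂ) * w) I := fun w => by fun_prop
  have hmeas : ∀ w ∈ Sector γ,
      AEStronglyMeasurable (fun t : ℝ => (t : ℂ)⁻¹ * G (t * w)) (volume.restrict I) := by
    intro w hw
    refine ContinuousOn.aestronglyMeasurable (ContinuousOn.mul ?_ ?_) hIm
    · exact ContinuousOn.inv₀ (by fun_prop) fun t ht => by exact_mod_cast (ne_of_gt (hI ht))
    · exact hG.continuousOn.comp (hcl w) (hmap w hw)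
  have hderiv : ∀ t ∈ I, ∀ w ∈ Sector γ,
      HasDerivAt (fun w => (t : ℂ)⁻¹ * G (t * w)) (deriv G (t * w)) w := by
    intro t ht w hw
    have ht0 : (t : ℂ) ≠ 0 := by exact_mod_cast (ne_of_gt (hI ht))
    have h1 : HasDerivAt G (deriv G (t * w)) (t * w) :=
      (hG.differentiableAt (hSo.mem_nhds (hmap w hw ht))).hasDerivAt
    have h2 : HasDerivAt (fun w => (t : ℂ)⁻¹ * G (t * w))
        ((t : ℂ)⁻¹ * (deriv G (t * w) * (t * 1))) w :=
      (h1.comp w ((hasDerivAt_id w).const_mul (t : ℂ))).const_mul (t : ℂ)⁻¹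
    rwa [mul_one, mul_comm (deriv G _), inv_mul_cancel_left₀ ht0] at h2
  have hsub : Metric.ball w₀ (δ / 2) ⊆ Sector γ := fun w hw =>
    (hball (Metric.ball_subset_ball (by linarith) hw)).2
  have main := hasDerivAt_integral_of_dominated_loc_of_deriv_le (𝕜 := ℂ)
    (μ := volume.restrict I) (F := fun w (t : ℝ) => (t : ℂ)⁻¹ * G (t * w))
    (F' := fun w (t : ℝ) => deriv G (t * w)) (x₀ := w₀)
    (bound := fun t => bound t / (δ / 2))
    (Metric.ball_mem_nhds w₀ (by linarith : 0 < δ / 2))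
    (Filter.eventually_of_mem (hSo.mem_nhds hw₀) hmeas) ?_ ?_ ?_ (hbi.div_const _) ?_
  · exact main.2.differentiableAt.differentiableWithinAt
  · refine Integrable.mono' hbi (hmeas w₀ hw₀) ?_
    exact (ae_restrict_iff' hIm).2 (Eventually.of_forall fun t ht =>
      hb t ht w₀ (mem_of_mem_nhds hU))
  · refine ContinuousOn.aestronglyMeasurable ?_ hIm
    exact ((hG.deriv hSo).continuousOn).comp (hcl w₀) (hmap w₀ hw₀)
  · refine (ae_restrict_iff' hIm).2 (Eventually.of_forall fun t ht w hw => ?_)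
    rw [← (hderiv t ht w (hsub hw)).deriv]
    have hin : Metric.closedBall w (δ / 2) ⊆ Metric.ball w₀ δ := fun v hv => by
      rw [Metric.mem_ball] at hw ⊢
      rw [Metric.mem_closedBall] at hv
      linarith [dist_triangle v w w₀]
    refine Complex.norm_deriv_le_of_forall_mem_sphere_norm_le (by linarith) ?_ fun v hv =>
      hb t ht v (hball (hin (Metric.sphere_subset_closedBall hv))).1
    refine DifferentiableOn.diffContOnCl (DifferentiableOn.mono (t := Sector γ) (fun v hv =>
      (hderiv t ht v hv).differentiableAt.differentiableWithinAt) ?_)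
    exact fun v hv => (hball (hin (Metric.closure_ball_subset_closedBall hv))).2
  · exact (ae_restrict_iff' hIm).2 (Eventually.of_forall fun t ht w hw =>
      hderiv t ht w (hsub hw))

namespace FlatKernel

variable {M : ℕ → ℝ} {γ : ℝ}

/-- The integrand `G (t w) / t` with `G v = v ^ (j + 1) * K v`. -/
def integrand (K : FlatKernel M γ) (j : ℕ) (w : ℂ) (t : ℝ) : ℂ :=
  (t : ℂ)⁻¹ * ((t * w) ^ (j + 1) * K.toFun (t * w))

/-- The moment of order `j` of the kernel on the positive axis. -/
def moment (K : FlatKernel M γ) (j : ℕ) : ℝ := ∫ t in Set.Ioi (0 : ℝ), t ^ j * K.onReal t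

theorem norm_integrand (K : FlatKernel M γ) (j : ℕ) (w : ℂ) {t : ℝ} (ht : 0 < t) :
    ‖K.integrand j w t‖ = t ^ j * ‖w‖ ^ (j + 1) * ‖K.toFun (t * w)‖ := by
  rw [integrand, norm_mul, norm_mul, norm_inv, norm_pow, norm_mul, Complex.norm_real,
    Real.norm_of_nonneg ht.le]
  field_simp
  ring

theorem norm_toFun_scaled_le (K : FlatKernel M γ) {w : ℂ} (hw : w ∈ Sector γ) {t : ℝ}
    (ht : 0 < t) (q : ℕ) : ‖K.toFun (t * w)‖ * (t ^ q * ‖w‖ ^ q) ≤ M q := by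
  have h := K.norm_mul_pow_le _ (Sector.ofReal_mul_mem ht hw) q
  rwa [norm_mul, Complex.norm_real, Real.norm_of_nonneg ht.le, mul_pow] at h

theorem norm_integrand_le_of_le_one (K : FlatKernel M γ) {w : ℂ} (hw : w ∈ Sector γ) {t : ℝ}
    (ht : 0 < t) (ht1 : t ≤ 1) {j q : ℕ} (hq : q ≤ j) :
    ‖K.integrand j w t‖ * ‖w‖ ^ q ≤ M q * ‖w‖ ^ (j + 1) := by
  have h := K.norm_toFun_scaled_le hw ht q
  have h1 : t ^ (j - q) ≤ 1 := pow_le_one₀ ht.le ht1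
  rw [K.norm_integrand j w ht]
  calc _ = t ^ (j - q) * (‖K.toFun (t * w)‖ * (t ^ q * ‖w‖ ^ q)) * ‖w‖ ^ (j + 1) := by
        rw [← Nat.sub_add_cancel hq, pow_add t, Nat.add_sub_cancel]; ring
    _ ≤ 1 * (‖K.toFun (t * w)‖ * (t ^ q * ‖w‖ ^ q)) * ‖w‖ ^ (j + 1) := by gcongr
    _ ≤ M q * ‖w‖ ^ (j + 1) := by rw [one_mul]; gcongr

theorem norm_integrand_le_of_one_le (K : FlatKernel M γ) {w : ℂ} (hw : w ∈ Sector γ) {t : ℝ}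
    (ht1 : 1 ≤ t) {j q : ℕ} (hq : j + 2 ≤ q) :
    ‖K.integrand j w t‖ * ‖w‖ ^ q ≤ M q * ‖w‖ ^ (j + 1) * t ^ (-2 : ℝ) := by
  have ht : 0 < t := by linarith
  have h := K.norm_toFun_scaled_le hw ht q
  have hM : 0 ≤ M q := le_trans (by positivity) h
  have h1 : t ^ j ≤ t ^ q * t ^ (-2 : ℝ) := by
    rw [← Real.rpow_natCast, ← Real.rpow_natCast, ← Real.rpow_add ht]
    refine Real.rpow_le_rpow_of_exponent_le ht1 ?_
    have : ((j + 2 : ℕ) : ℝ) ≤ q := by exact_mod_cast hq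
    push_cast at this
    linarith
  rw [K.norm_integrand j w ht]
  calc _ ≤ (t ^ q * t ^ (-2 : ℝ)) * ‖w‖ ^ (j + 1) * ‖K.toFun (t * w)‖ * ‖w‖ ^ q := by gcongr
    _ = (‖K.toFun (t * w)‖ * (t ^ q * ‖w‖ ^ q)) * (‖w‖ ^ (j + 1) * t ^ (-2 : ℝ)) := by ring
    _ ≤ M q * (‖w‖ ^ (j + 1) * t ^ (-2 : ℝ)) := by gcongr
    _ = _ := by ring

theorem aestronglyMeasurable_integrand (K : FlatKernel M γ) (j : ℕ) {w : ℂ}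
    (hw : w ∈ Sector γ) {I : Set ℝ} (hI : I ⊆ Set.Ioi 0) (hIm : MeasurableSet I) :
    AEStronglyMeasurable (K.integrand j w) (volume.restrict I) := by
  refine ContinuousOn.aestronglyMeasurable (ContinuousOn.mul ?_ (ContinuousOn.mul ?_ ?_)) hIm
  · exact ContinuousOn.inv₀ (by fun_prop) fun t ht => by exact_mod_cast (ne_of_gt (hI ht))
  · fun_prop
  · exact K.differentiableOn.continuousOn.comp (by fun_prop)
      fun t ht => Sector.ofReal_mul_mem (hI ht) hw

theorem integrableOn_Ioc_integrand (K : FlatKernel M γ) (j : ℕ) {w : ℂ}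
    (hw : w ∈ Sector γ) : IntegrableOn (K.integrand j w) (Set.Ioc 0 1) := by
  refine Integrable.mono' (g := fun _ => M 0 * ‖w‖ ^ (j + 1))
    (integrableOn_const (by simp))
    (K.aestronglyMeasurable_integrand j hw Set.Ioc_subset_Ioi_self measurableSet_Ioc) ?_
  refine (ae_restrict_iff' measurableSet_Ioc).2 (Eventually.of_forall fun t ht => ?_)
  simpa using K.norm_integrand_le_of_le_one hw ht.1 ht.2 (Nat.zero_le j)

theorem norm_integrand_le_of_one_le' (K : FlatKernel M γ) {w : ℂ} (hw : w ∈ Sector γ) {t : ℝ}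
    (ht1 : 1 ≤ t) (j : ℕ) : ‖K.integrand j w t‖ ≤ M (j + 2) / ‖w‖ * t ^ (-2 : ℝ) := by
  have h := K.norm_integrand_le_of_one_le hw ht1 (le_refl (j + 2))
  have hw0 : 0 < ‖w‖ := norm_pos_iff.2 hw.1
  rw [div_mul_eq_mul_div, le_div_iff₀ hw0]
  refine le_of_mul_le_mul_right ?_ (pow_pos hw0 (j + 1))
  calc _ = ‖K.integrand j w t‖ * ‖w‖ ^ (j + 2) := by ring
    _ ≤ _ := h
    _ = _ := by ring

theorem integrableOn_Ioi_one_integrand (K : FlatKernel M γ) (j : ℕ) {w : ℂ}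
    (hw : w ∈ Sector γ) : IntegrableOn (K.integrand j w) (Set.Ioi 1) := by
  refine Integrable.mono' (g := fun t => M (j + 2) / ‖w‖ * t ^ (-2 : ℝ))
    ((integrableOn_Ioi_rpow_of_lt (by norm_num) one_pos).const_mul _)
    (K.aestronglyMeasurable_integrand j hw (Set.Ioi_subset_Ioi zero_le_one) measurableSet_Ioi) ?_
  exact (ae_restrict_iff' measurableSet_Ioi).2 (Eventually.of_forall fun t ht =>
    K.norm_integrand_le_of_one_le' hw (le_of_lt ht) j)

/-- The part near the origin of the integral of the kernel along the ray through `w`. -/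
def head (K : FlatKernel M γ) (j : ℕ) (w : ℂ) : ℂ := ∫ t in Set.Ioc 0 1, K.integrand j w t

/-- The part at infinity of the integral of the kernel along the ray through `w`. -/
def tail (K : FlatKernel M γ) (j : ℕ) (w : ℂ) : ℂ := ∫ t in Set.Ioi 1, K.integrand j w t

theorem head_add_tail (K : FlatKernel M γ) (j : ℕ) {w : ℂ} (hw : w ∈ Sector γ) :
    K.head j w + K.tail j w = ∫ t in Set.Ioi 0, K.integrand j w t := by
  rw [head, tail, ← setIntegral_union (Set.Ioc_disjoint_Ioi le_rfl) measurableSet_Ioi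
    (K.integrableOn_Ioc_integrand j hw) (K.integrableOn_Ioi_one_integrand j hw),
    Set.Ioc_union_Ioi_eq_Ioi zero_le_one]

theorem differentiableOn_integrand_core (K : FlatKernel M γ) (j : ℕ) :
    DifferentiableOn ℂ (fun v => v ^ (j + 1) * K.toFun v) (Sector γ) :=
  (differentiableOn_id.pow _).mul K.differentiableOn

theorem differentiableOn_head (hγ : γ ≤ 2) (K : FlatKernel M γ) (j : ℕ) :
    DifferentiableOn ℂ (K.head j) (Sector γ) := by
  refine differentiableOn_integral_scaled hγ (K.differentiableOn_integrand_core j)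
    Set.Ioc_subset_Ioi_self measurableSet_Ioc fun w₀ hw₀ => ?_
  refine ⟨Metric.ball w₀ 1 ∩ Sector γ, Filter.inter_mem (Metric.ball_mem_nhds _ one_pos)
    ((Sector.isOpen hγ).mem_nhds hw₀), fun _ => M 0 * (‖w₀‖ + 1) ^ (j + 1),
    integrableOn_const (by simp), fun t ht w hw => ?_⟩
  have h := K.norm_integrand_le_of_le_one hw.2 ht.1 ht.2 (Nat.zero_le j)
  have h0 := K.norm_toFun_scaled_le hw.2 ht.1 0
  have hM : 0 ≤ M 0 := le_trans (by positivity) h0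
  rw [pow_zero, mul_one] at h
  refine h.trans ?_
  have : ‖w‖ ≤ ‖w₀‖ + 1 := by
    have h1 := hw.1
    rw [mem_ball_iff_norm] at h1
    linarith [norm_le_norm_add_norm_sub' w w₀]
  beta_reduce
  gcongr

theorem differentiableOn_tail (hγ : γ ≤ 2) (K : FlatKernel M γ) (j : ℕ) :
    DifferentiableOn ℂ (K.tail j) (Sector γ) := by
  refine differentiableOn_integral_scaled hγ (K.differentiableOn_integrand_core j)
    (Set.Ioi_subset_Ioi zero_le_one) measurableSet_Ioi fun w₀ hw₀ => ?_
  have hw0 : 0 < ‖w₀‖ := norm_pos_iff.2 hw₀.1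
  refine ⟨Metric.ball w₀ (‖w₀‖ / 2) ∩ Sector γ,
    Filter.inter_mem (Metric.ball_mem_nhds _ (by positivity))
    ((Sector.isOpen hγ).mem_nhds hw₀), fun t => M (j + 2) / (‖w₀‖ / 2) * t ^ (-2 : ℝ),
    (integrableOn_Ioi_rpow_of_lt (by norm_num) one_pos).const_mul _, fun t ht w hw => ?_⟩
  have ht0 : 0 < t := lt_trans one_pos ht
  have h := K.norm_integrand_le_of_one_le' hw.2 (le_of_lt ht) j
  have h0 := K.norm_toFun_scaled_le hw.2 ht0 (j + 2)
  have hM : 0 ≤ M (j + 2) := le_trans (by positivity) h0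
  refine h.trans ?_
  have : ‖w₀‖ / 2 ≤ ‖w‖ := by
    have h1 := hw.1
    rw [mem_ball_iff_norm'] at h1
    linarith [norm_le_norm_add_norm_sub' w₀ w]
  beta_reduce
  gcongr

theorem integrand_one (K : FlatKernel M γ) (j : ℕ) {t : ℝ} (ht : 0 < t) :
    K.integrand j 1 t = ((t ^ j * K.onReal t : ℝ) : ℂ) := by
  have ht0 : (t : ℂ) ≠ 0 := by exact_mod_cast ht.ne'
  simp only [integrand, mul_one]
  rw [K.toFun_ofReal t ht, pow_succ']
  push_cast
  field_simp

theorem integral_integrand_one (K : FlatKernel M γ) (j : ℕ) :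
    ∫ t in Set.Ioi 0, K.integrand j 1 t = (K.moment j : ℂ) := by
  rw [moment, ← integral_complex_ofReal]
  exact setIntegral_congr_fun measurableSet_Ioi fun t ht => K.integrand_one j ht

theorem integral_integrand_ofReal (K : FlatKernel M γ) (j : ℕ) {x : ℝ}
    (hx : 0 < x) : ∫ t in Set.Ioi 0, K.integrand j x t = (K.moment j : ℂ) := by
  rw [← K.integral_integrand_one]
  have h := integral_comp_mul_left_Ioi (fun t => K.integrand j 1 t) 0 hx
  rw [mul_zero] at h
  have hx0 : (x : ℂ) ≠ 0 := by exact_mod_cast hx.ne'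
  have h2 : ∀ t : ℝ, K.integrand j x t = x * K.integrand j 1 (x * t) := fun t => by
    simp only [integrand, mul_one]
    push_cast
    rw [mul_inv, mul_comm (t : ℂ) x]
    field_simp
  simp only [h2]
  rw [integral_const_mul, h]
  rw [Complex.real_smul]
  push_cast
  field_simp

theorem head_add_tail_eq_moment (hγ0 : 0 < γ) (hγ : γ ≤ 2) (K : FlatKernel M γ) (j : ℕ) {w : ℂ}
    (hw : w ∈ Sector γ) : K.head j w + K.tail j w = K.moment j := by
  have hSo := Sector.isOpen hγ
  have hd : DifferentiableOn ℂ (fun w => K.head j w + K.tail j w) (Sector γ) :=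
    (K.differentiableOn_head hγ j).add (K.differentiableOn_tail hγ j)
  have h1 : (1 : ℂ) ∈ Sector γ := by
    simpa using Sector.ofReal_mem hγ0 one_pos
  refine (hd.analyticOnNhd hSo).eqOn_of_preconnected_of_frequently_eq
    (g := fun _ => (K.moment j : ℂ)) analyticOnNhd_const (Sector.isPreconnected hγ) h1 ?_ hw
  have hfreq : ∃ᶠ x : ℝ in 𝓝[≠] 1,
      K.head j (x : ℂ) + K.tail j (x : ℂ) = (K.moment j : ℂ) := by
    refine Filter.Eventually.frequently (mem_nhdsWithin_of_mem_nhds ?_)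
    filter_upwards [Ioi_mem_nhds (zero_lt_one' ℝ)] with x hx
    rw [K.head_add_tail j (Sector.ofReal_mem hγ0 hx), K.integral_integrand_ofReal j hx]
  refine Filter.Tendsto.frequently (f := fun x : ℝ => (x : ℂ)) ?_ hfreq
  refine tendsto_nhdsWithin_iff.2 ⟨?_, ?_⟩
  · have : Tendsto (fun x : ℝ => (x : ℂ)) (𝓝 1) (𝓝 ((1 : ℝ) : ℂ)) :=
      Complex.continuous_ofReal.tendsto 1
    simpa using this.mono_left nhdsWithin_le_nhds
  · filter_upwards [self_mem_nhdsWithin] with x hx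
    simpa using hx

theorem norm_head_mul_pow_le (K : FlatKernel M γ) {w : ℂ} (hw : w ∈ Sector γ) {j q : ℕ}
    (hq : q ≤ j) : ‖K.head j w‖ * ‖w‖ ^ q ≤ M q * ‖w‖ ^ (j + 1) := by
  have hw0 : 0 < ‖w‖ := norm_pos_iff.2 hw.1
  have h := norm_setIntegral_le_of_norm_le_const (μ := volume) (s := Set.Ioc (0 : ℝ) 1)
    (f := K.integrand j w) (C := M q * ‖w‖ ^ (j + 1) / ‖w‖ ^ q) (by simp) fun t ht => by
      rw [le_div_iff₀ (by positivity)]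
      exact K.norm_integrand_le_of_le_one hw ht.1 ht.2 hq
  rw [← le_div_iff₀ (by positivity)]
  simpa [head] using h

theorem norm_tail_mul_pow_le (K : FlatKernel M γ) {w : ℂ} (hw : w ∈ Sector γ) {j q : ℕ}
    (hq : j + 2 ≤ q) : ‖K.tail j w‖ * ‖w‖ ^ q ≤ M q * ‖w‖ ^ (j + 1) := by
  have hw0 : 0 < ‖w‖ := norm_pos_iff.2 hw.1
  rw [← le_div_iff₀ (by positivity)]
  have h := norm_integral_le_of_norm_le (μ := volume.restrict (Set.Ioi (1 : ℝ)))
    (f := K.integrand j w) (g := fun t => M q * ‖w‖ ^ (j + 1) / ‖w‖ ^ q * t ^ (-2 : ℝ))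
    ((integrableOn_Ioi_rpow_of_lt (by norm_num) one_pos).const_mul _)
    ((ae_restrict_iff' measurableSet_Ioi).2 (Eventually.of_forall fun t ht => by
      rw [div_mul_eq_mul_div, le_div_iff₀ (by positivity)]
      exact K.norm_integrand_le_of_one_le hw (le_of_lt ht) hq))
  rw [integral_const_mul, integral_Ioi_rpow_of_lt (by norm_num) one_pos] at h
  norm_num at h
  exact h

theorem moment_lower_bound (hpos : ∀ j, 0 < M j) (hγ0 : 0 < γ) (K : FlatKernel M γ) (j : ℕ) :
    M (j + 1) ≤ (2 * K.B) ^ (j + 1) * K.moment j := by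
  set m : ℝ := M (j + 1) / M j with hm_def
  have hm : 0 < m := div_pos (hpos _) (hpos _)
  have hB : 0 < K.B := lt_of_lt_of_le one_pos K.one_le_B
  have h1 : (1 : ℂ) ∈ Sector γ := by
    simpa using Sector.ofReal_mem hγ0 one_pos
  have hint : IntegrableOn (fun t => t ^ j * K.onReal t) (Set.Ioi 0) := by
    have h2 : IntegrableOn (K.integrand j 1) (Set.Ioi 0) := by
      rw [← Set.Ioc_union_Ioi_eq_Ioi (zero_le_one' ℝ)]
      exact (K.integrableOn_Ioc_integrand j h1).union (K.integrableOn_Ioi_one_integrand j h1)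
    refine IntegrableOn.congr_fun (Integrable.re h2) (fun t ht => ?_) measurableSet_Ioi
    rw [K.integrand_one j ht, RCLike.re_eq_complex_re, Complex.ofReal_re]
  have hsub : Set.Ioc (m / 2) m ⊆ Set.Ioi 0 := fun t ht => lt_trans (by positivity) ht.1
  have hlow := setIntegral_ge_of_const_le (μ := volume) (s := Set.Ioc (m / 2) m)
    (f := fun t => t ^ j * K.onReal t) (c := (m / 2) ^ j * ((M j / m ^ j) / K.B ^ (j + 1)))
    measurableSet_Ioc (by simp) (fun t ht => by
      have ht0 : 0 < t := hsub ht
      have h3 := K.le_onReal j t ht0 ht.2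
      have h4 : M j / m ^ j / K.B ^ (j + 1) ≤ K.onReal t := by
        rw [div_le_iff₀ (by positivity), mul_comm]
        exact h3
      have h5 : m / 2 ≤ t := ht.1.le
      have := (hpos j).le
      gcongr) (hint.mono_set hsub)
  have hle : ∫ t in Set.Ioc (m / 2) m, t ^ j * K.onReal t ≤ K.moment j :=
    setIntegral_mono_set hint ((ae_restrict_iff' measurableSet_Ioi).2
      (Eventually.of_forall fun t ht =>
        mul_nonneg (pow_nonneg (le_of_lt ht) _) (K.onReal_pos t ht).le))
      hsub.eventuallyLE
  have hfin := hlow.trans hle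
  simp only [measureReal_def, Real.volume_Ioc, smul_eq_mul] at hfin
  rw [ENNReal.toReal_ofReal (by linarith)] at hfin
  have hMj := hpos j
  calc M (j + 1) = (2 * K.B) ^ (j + 1) *
        ((m - m / 2) * ((m / 2) ^ j * ((M j / m ^ j) / K.B ^ (j + 1)))) := by
        have : M (j + 1) = m * M j := by rw [hm_def]; field_simp
        rw [this, mul_pow, div_pow]
        field_simp
        ring
    _ ≤ _ := by gcongr

end FlatKernel

theorem FlatKernel.norm_head_or_tail_mul_pow_le {M : ℕ → ℝ} {γ A : ℝ} (hpos : ∀ j, 0 < M j)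
    (hA : 1 ≤ A) (hmg : ∀ j k : ℕ, M (j + k) ≤ A ^ (j + k) * (M j * M k)) (hγ0 : 0 < γ)
    (hγ : γ ≤ 2) (K : FlatKernel M γ) {w : ℂ} (hw : w ∈ Sector γ) (j p : ℕ) :
    ‖if p ≤ j then K.head j w else K.tail j w‖ * ‖w‖ ^ p ≤
      (1 + A * M 1 + 2 * (A ^ 2 * M 2)) * A ^ p * M p * ‖w‖ ^ j := by
  have hw0 : 0 < ‖w‖ := norm_pos_iff.2 hw.1
  have hM1 := hpos 1
  have hM2 := hpos 2
  have hMp := hpos p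
  have hshift : M (p + 1) ≤ (1 + A * M 1 + 2 * (A ^ 2 * M 2)) * A ^ p * M p := by
    calc M (p + 1) ≤ A ^ (p + 1) * (M p * M 1) := hmg p 1
      _ = (A * M 1) * A ^ p * M p := by ring
      _ ≤ _ := by
        gcongr
        have : 0 ≤ A ^ 2 * M 2 := by positivity
        linarith
  have cancel : ∀ D : ℂ, ‖D‖ * ‖w‖ ^ (p + 1) ≤ M (p + 1) * ‖w‖ ^ (j + 1) →
      ‖D‖ * ‖w‖ ^ p ≤ (1 + A * M 1 + 2 * (A ^ 2 * M 2)) * A ^ p * M p * ‖w‖ ^ j := by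
    intro D hD
    refine le_of_mul_le_mul_right ?_ hw0
    calc ‖D‖ * ‖w‖ ^ p * ‖w‖ = ‖D‖ * ‖w‖ ^ (p + 1) := by ring
      _ ≤ M (p + 1) * ‖w‖ ^ (j + 1) := hD
      _ ≤ _ := by
        rw [pow_succ ‖w‖ j, ← mul_assoc]
        gcongr
  rcases lt_trichotomy p j with hpj | rfl | hpj
  · rw [if_pos hpj.le]
    exact cancel _ (K.norm_head_mul_pow_le hw hpj)
  · rw [if_pos le_rfl]
    gcongr
    have h1 : (1 : ℂ) ∈ Sector γ := by
      simpa using Sector.ofReal_mem hγ0 one_pos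
    have hpp : M (p + 2) ≤ A ^ 2 * M 2 * A ^ p * M p :=
      (hmg p 2).trans_eq (by ring)
    have hAp : M p ≤ A ^ p * M p := le_mul_of_one_le_left hMp.le (one_le_pow₀ hA)
    have htot : M p + 2 * M (p + 2) ≤ (1 + A * M 1 + 2 * (A ^ 2 * M 2)) * A ^ p * M p := by
      have : 0 ≤ A * M 1 * (A ^ p * M p) := by positivity
      linarith
    refine le_trans ?_ htot
    rcases le_total ‖w‖ 1 with hw1 | hw1
    · have h := K.norm_head_mul_pow_le hw (le_refl p)
      have h2 : ‖K.head p w‖ ≤ M p * ‖w‖ := by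
        refine le_of_mul_le_mul_right ?_ (pow_pos hw0 p)
        rwa [mul_assoc, ← pow_succ']
      have := (hpos (p + 2)).le
      nlinarith
    · have h := K.norm_tail_mul_pow_le hw (le_refl (p + 2))
      have h2 : ‖K.tail p w‖ ≤ M (p + 2) := by
        have h3 : ‖K.tail p w‖ * ‖w‖ ≤ M (p + 2) := by
          refine le_of_mul_le_mul_right ?_ (pow_pos hw0 (p + 1))
          rwa [mul_assoc, ← pow_succ']
        exact (le_mul_of_one_le_right (norm_nonneg _) hw1).trans h3
      have h4 := K.norm_head_mul_pow_le h1 (le_refl p)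
      have h5 := K.norm_tail_mul_pow_le h1 (le_refl (p + 2))
      simp only [norm_one, one_pow, mul_one] at h4 h5
      have h6 : K.head p w = K.head p 1 + K.tail p 1 - K.tail p w := by
        rw [K.head_add_tail_eq_moment hγ0 hγ p h1, ← K.head_add_tail_eq_moment hγ0 hγ p hw]
        ring
      rw [h6]
      have h7 := norm_sub_le (K.head p 1 + K.tail p 1) (K.tail p w)
      have h8 := norm_add_le (K.head p 1) (K.tail p 1)
      linarith
  · rw [if_neg (by omega)]
    exact cancel _ (K.norm_tail_mul_pow_le hw (by omega))

theorem exists_holomorphic_cutoffs {M : ℕ → ℝ} (hM : StronglyRegular M) {γ γ' : ℝ}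
    (hγ0 : 0 < γ) (hγ : γ ≤ 2) (hγγ' : γ < γ') (hP : PropertyP M γ') :
    ∃ (X : ℕ → ℂ → ℂ) (H d : ℝ), 0 ≤ H ∧ 1 ≤ d ∧
      (∀ j, DifferentiableOn ℂ (X j) (Sector γ)) ∧
      ∀ j p : ℕ, ∀ z ∈ Sector γ, M j * ‖z‖ ^ j * ‖X j z - if p ≤ j then 0 else 1‖ ≤
        H * (1 / 2) ^ j * (d ^ p * M p * ‖z‖ ^ p) := by
  obtain ⟨A, hpos, hM0, hmono, hconv, hA, hmg, -⟩ := hM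
  obtain ⟨K⟩ := exists_flatKernel hpos hM0 hconv hγ0 hγ hγγ' hP
  have hB1 := K.one_le_B
  have hB : 0 < K.B := lt_of_lt_of_le one_pos hB1
  have hmom : ∀ j, M j ≤ (2 * K.B) ^ (j + 1) * K.moment j := fun j =>
    (hmono j.le_succ).trans (K.moment_lower_bound hpos hγ0 j)
  have hmompos : ∀ j, 0 < K.moment j := fun j => by
    have h := (hpos j).trans_le (hmom j)
    exact pos_of_mul_pos_right h (by positivity)
  set R : ℝ := 1 / (4 * K.B) with hR_def
  have hR : 0 < R := by positivity
  have hmem : ∀ z ∈ Sector γ, (R : ℂ) * z⁻¹ ∈ Sector γ := fun z hz =>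
    Sector.ofReal_mul_mem hR (Sector.inv_mem hz)
  have hH : 0 ≤ 1 + A * M 1 + 2 * (A ^ 2 * M 2) := by
    have := hpos 1
    have := hpos 2
    positivity
  refine ⟨fun j z => K.head j (R * z⁻¹) / K.moment j,
    2 * K.B * (1 + A * M 1 + 2 * (A ^ 2 * M 2)), A * (4 * K.B), by positivity,
    by nlinarith, fun j => ?_, fun j p z hz => ?_⟩
  · refine DifferentiableOn.div_const ((K.differentiableOn_head hγ j).comp ?_ hmem) _
    exact (differentiableOn_inv.mono fun z hz => hz.1).const_mul _
  · have hz0 : 0 < ‖z‖ := norm_pos_iff.2 hz.1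
    have hμ := hmompos j
    have hμC : (K.moment j : ℂ) ≠ 0 := by exact_mod_cast hμ.ne'
    have hw := hmem z hz
    have hwn : ‖(R : ℂ) * z⁻¹‖ = R / ‖z‖ := by
      rw [norm_mul, norm_inv, Complex.norm_real, Real.norm_of_nonneg hR.le, div_eq_mul_inv]
    have hD := K.norm_head_or_tail_mul_pow_le hpos hA hmg hγ0 hγ hw j p
    set D : ℂ := if p ≤ j then K.head j (R * z⁻¹) else K.tail j (R * z⁻¹) with hD_def
    have hX : ‖K.head j (R * z⁻¹) / K.moment j - if p ≤ j then 0 else 1‖ = ‖D‖ / K.moment j := by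
      have hnorm : ‖(K.moment j : ℂ)‖ = K.moment j := by
        rw [Complex.norm_real, Real.norm_of_nonneg hμ.le]
      by_cases hpj : p ≤ j
      · simp only [hD_def, if_pos hpj]
        rw [sub_zero, norm_div, hnorm]
      · simp only [hD_def, if_neg hpj]
        rw [div_sub_one hμC, norm_div, hnorm, ← K.head_add_tail_eq_moment hγ0 hγ j hw,
          sub_add_cancel_left, norm_neg]
    rw [hwn, ← le_div_iff₀ (by positivity)] at hD
    rw [hX]
    have hMp := (hpos p).le
    have hMj := (hpos j).le
    calc M j * ‖z‖ ^ j * (‖D‖ / K.moment j)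
        ≤ ((2 * K.B) ^ (j + 1) * K.moment j) * ‖z‖ ^ j *
          (((1 + A * M 1 + 2 * (A ^ 2 * M 2)) * A ^ p * M p * (R / ‖z‖) ^ j / (R / ‖z‖) ^ p) /
            K.moment j) := by
          gcongr
          exact hmom j
      _ = _ := by
        rw [hR_def]
        simp only [div_pow, mul_pow, one_pow, pow_succ]
        have h4 : (4 : ℝ) ^ j = 2 ^ j * 2 ^ j := by rw [← mul_pow]; norm_num
        rw [h4]
        field_simp

/-- The series `∑ (λ_j / j!) z ^ j X_j(σ z)` on a sector, extended by zero. -/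
def cutoffSeries (γ : ℝ) (X : ℕ → ℂ → ℂ) (σ : ℝ) (lam : ℕ → ℂ) : ℂ → ℂ :=
  (Sector γ).indicator fun z => ∑' j, lam j / (Nat.factorial j : ℂ) * z ^ j * X j (σ * z)

section CutoffSeries

variable {M : ℕ → ℝ} {γ σ H d : ℝ} {X : ℕ → ℂ → ℂ}

theorem norm_cutoffSeries_term_sub_le (hσ : 0 < σ)
    (hX : ∀ j p : ℕ, ∀ z ∈ Sector γ, M j * ‖z‖ ^ j * ‖X j z - if p ≤ j then 0 else 1‖ ≤
      H * (1 / 2) ^ j * (d ^ p * M p * ‖z‖ ^ p)) {lam : ℕ → ℂ} {C : ℝ} (hC : 0 ≤ C)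
    (hlam : ∀ j : ℕ, ‖lam j‖ ≤ C * σ ^ j * (Nat.factorial j : ℝ) * M j) {z : ℂ}
    (hz : z ∈ Sector γ) (j p : ℕ) :
    ‖lam j / (Nat.factorial j : ℂ) * z ^ j * (X j (σ * z) - if p ≤ j then 0 else 1)‖ ≤
      (1 / 2) ^ j * (H * C * (d * σ) ^ p * M p * ‖z‖ ^ p) := by
  have h := hX j p _ (Sector.ofReal_mul_mem hσ hz)
  rw [norm_mul (σ : ℂ) z, Complex.norm_real, Real.norm_of_nonneg hσ.le] at h
  have hf : (0 : ℝ) < Nat.factorial j := by exact_mod_cast Nat.factorial_pos j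
  have ha : ‖lam j / (Nat.factorial j : ℂ)‖ ≤ C * σ ^ j * M j := by
    rw [norm_div, Complex.norm_natCast, div_le_iff₀ hf]
    exact (hlam j).trans_eq (by ring)
  rw [norm_mul, norm_mul, norm_pow]
  calc _ ≤ C * σ ^ j * M j * ‖z‖ ^ j * ‖X j (σ * z) - if p ≤ j then 0 else 1‖ := by gcongr
    _ = C * (M j * (σ * ‖z‖) ^ j * ‖X j (σ * z) - if p ≤ j then 0 else 1‖) := by ring
    _ ≤ C * (H * (1 / 2) ^ j * (d ^ p * M p * (σ * ‖z‖) ^ p)) := by gcongr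
    _ = _ := by ring

theorem norm_cutoffSeries_term_le (hσ : 0 < σ)
    (hX : ∀ j p : ℕ, ∀ z ∈ Sector γ, M j * ‖z‖ ^ j * ‖X j z - if p ≤ j then 0 else 1‖ ≤
      H * (1 / 2) ^ j * (d ^ p * M p * ‖z‖ ^ p)) {lam : ℕ → ℂ} {C : ℝ} (hC : 0 ≤ C)
    (hlam : ∀ j : ℕ, ‖lam j‖ ≤ C * σ ^ j * (Nat.factorial j : ℝ) * M j) {z : ℂ}
    (hz : z ∈ Sector γ) (j : ℕ) :
    ‖lam j / (Nat.factorial j : ℂ) * z ^ j * X j (σ * z)‖ ≤ (1 / 2) ^ j * (H * C * M 0) := by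
  simpa using norm_cutoffSeries_term_sub_le hσ hX hC hlam hz j 0

theorem summable_cutoffSeries (hσ : 0 < σ)
    (hX : ∀ j p : ℕ, ∀ z ∈ Sector γ, M j * ‖z‖ ^ j * ‖X j z - if p ≤ j then 0 else 1‖ ≤
      H * (1 / 2) ^ j * (d ^ p * M p * ‖z‖ ^ p)) {lam : ℕ → ℂ} {C : ℝ} (hC : 0 ≤ C)
    (hlam : ∀ j : ℕ, ‖lam j‖ ≤ C * σ ^ j * (Nat.factorial j : ℝ) * M j) {z : ℂ}
    (hz : z ∈ Sector γ) :
    Summable fun j => lam j / (Nat.factorial j : ℂ) * z ^ j * X j (σ * z) :=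
  Summable.of_norm_bounded (summable_geometric_two.mul_right _)
    (norm_cutoffSeries_term_le hσ hX hC hlam hz)

theorem differentiableOn_cutoffSeries (hγ : γ ≤ 2) (hσ : 0 < σ)
    (hXd : ∀ j, DifferentiableOn ℂ (X j) (Sector γ))
    (hX : ∀ j p : ℕ, ∀ z ∈ Sector γ, M j * ‖z‖ ^ j * ‖X j z - if p ≤ j then 0 else 1‖ ≤
      H * (1 / 2) ^ j * (d ^ p * M p * ‖z‖ ^ p)) {lam : ℕ → ℂ} {C : ℝ} (hC : 0 ≤ C)
    (hlam : ∀ j : ℕ, ‖lam j‖ ≤ C * σ ^ j * (Nat.factorial j : ℝ) * M j) :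
    DifferentiableOn ℂ (cutoffSeries γ X σ lam) (Sector γ) := by
  have h := Complex.differentiableOn_tsum_of_summable_norm
    (F := fun j z => lam j / (Nat.factorial j : ℂ) * z ^ j * X j (σ * z))
    (summable_geometric_two.mul_right (H * C * M 0)) (fun j => ?_) (Sector.isOpen hγ)
    fun j z hz => norm_cutoffSeries_term_le hσ hX hC hlam hz j
  · exact h.congr fun z hz => Set.indicator_of_mem hz _
  · refine DifferentiableOn.mul (by fun_prop) ((hXd j).comp (by fun_prop) fun z hz => ?_)
    exact Sector.ofReal_mul_mem hσ hz

theorem norm_cutoffSeries_sub_le (hσ : 0 < σ)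
    (hX : ∀ j p : ℕ, ∀ z ∈ Sector γ, M j * ‖z‖ ^ j * ‖X j z - if p ≤ j then 0 else 1‖ ≤
      H * (1 / 2) ^ j * (d ^ p * M p * ‖z‖ ^ p)) {lam : ℕ → ℂ} {C : ℝ} (hC : 0 ≤ C)
    (hlam : ∀ j : ℕ, ‖lam j‖ ≤ C * σ ^ j * (Nat.factorial j : ℝ) * M j) {z : ℂ}
    (hz : z ∈ Sector γ) (p : ℕ) :
    ‖cutoffSeries γ X σ lam z -
        ∑ j ∈ Finset.range p, lam j / (Nat.factorial j : ℂ) * z ^ j‖ ≤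
      2 * H * C * (d * σ) ^ p * M p * ‖z‖ ^ p := by
  have h1 := (summable_cutoffSeries hσ hX hC hlam hz).hasSum
  have h2 : HasSum (fun j => lam j / (Nat.factorial j : ℂ) * z ^ j * (if p ≤ j then 0 else 1))
      (∑ j ∈ Finset.range p, lam j / (Nat.factorial j : ℂ) * z ^ j) := by
    have h3 : ∑ j ∈ Finset.range p, lam j / (Nat.factorial j : ℂ) * z ^ j =
        ∑ j ∈ Finset.range p,
          lam j / (Nat.factorial j : ℂ) * z ^ j * (if p ≤ j then (0 : ℂ) else 1) :=
      Finset.sum_congr rfl fun j hj => by rw [if_neg (by simpa using hj), mul_one]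
    rw [h3]
    refine hasSum_sum_of_ne_finset_zero fun j hj => ?_
    rw [Finset.mem_range, not_lt] at hj
    rw [if_pos hj, mul_zero]
  have h4 := h1.sub h2
  rw [cutoffSeries, Set.indicator_of_mem hz, ← h4.tsum_eq]
  refine (tsum_of_norm_bounded (hasSum_geometric_two.mul_right
    (H * C * (d * σ) ^ p * M p * ‖z‖ ^ p)) fun j => ?_).trans_eq (by ring)
  rw [← mul_sub]
  exact norm_cutoffSeries_term_sub_le hσ hX hC hlam hz j p

end CutoffSeries

theorem iteratedDeriv_sub_sum_range {S : Set ℂ} (hS : IsOpen S) {f : ℂ → ℂ}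
    (hf : DifferentiableOn ℂ f S) (a : ℕ → ℂ) (p n : ℕ) {z : ℂ} (hz : z ∈ S) :
    iteratedDeriv p (fun u => f u - ∑ j ∈ Finset.range n, a j * u ^ j) z =
      iteratedDeriv p f z -
        ∑ j ∈ Finset.range n, a j * ((j.descFactorial p : ℂ) * z ^ (j - p)) := by
  have hfc : ContDiffAt ℂ p f z := (hf.contDiffOn hS).contDiffAt (hS.mem_nhds hz)
  rw [iteratedDeriv_fun_sub hfc (by fun_prop), iteratedDeriv_fun_sum fun j _ => by fun_prop]
  congr 1
  refine Finset.sum_congr rfl fun j _ => ?_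
  rw [iteratedDeriv_const_mul_field, iteratedDeriv_pow]

theorem norm_iteratedDeriv_le_of_sector {γ γ₁ ε : ℝ} (hε : 0 < ε)
    (hball : ∀ z ∈ Sector γ, Metric.closedBall z (ε * ‖z‖) ⊆ Sector γ₁) {g : ℂ → ℂ}
    (hg : DifferentiableOn ℂ g (Sector γ₁)) {Q : ℝ} (hQ : 0 ≤ Q) {n : ℕ}
    (hbd : ∀ z ∈ Sector γ₁, ‖g z‖ ≤ Q * ‖z‖ ^ n) (p : ℕ) {z : ℂ} (hz : z ∈ Sector γ) :
    ‖iteratedDeriv p g z‖ ≤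
      (Nat.factorial p : ℝ) * (Q * ((1 + ε) * ‖z‖) ^ n) / (ε * ‖z‖) ^ p := by
  have hz0 : 0 < ‖z‖ := norm_pos_iff.2 hz.1
  refine Complex.norm_iteratedDeriv_le_of_forall_mem_sphere_norm_le p (by positivity) ?_ ?_
  · refine (hg.mono ?_).diffContOnCl
    exact Metric.closure_ball_subset_closedBall.trans (hball z hz)
  · intro v hv
    have hv' := Metric.sphere_subset_closedBall hv
    refine (hbd v (hball z hz hv')).trans ?_
    have : ‖v‖ ≤ (1 + ε) * ‖z‖ := by
      rw [mem_closedBall_iff_norm] at hv'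
      linarith [norm_le_norm_add_norm_sub' v z]
    gcongr

theorem norm_iteratedDeriv_le_of_asymptotic {γ γ₁ ε : ℝ} (hγ₁ : γ < γ₁) (hγ₂ : γ₁ ≤ 2)
    (hε : 0 < ε) (hball : ∀ z ∈ Sector γ, Metric.closedBall z (ε * ‖z‖) ⊆ Sector γ₁)
    {f : ℂ → ℂ} (hf : DifferentiableOn ℂ f (Sector γ₁)) {a : ℕ → ℂ} {Q : ℝ} (hQ : 0 ≤ Q) {p : ℕ}
    (hbd : ∀ z ∈ Sector γ₁, ‖f z - ∑ j ∈ Finset.range p, a j * z ^ j‖ ≤ Q * ‖z‖ ^ p) {z : ℂ}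
    (hz : z ∈ Sector γ) :
    ‖iteratedDeriv p f z‖ ≤ (Nat.factorial p : ℝ) * Q * ((1 + ε) / ε) ^ p := by
  have hz0 : 0 < ‖z‖ := norm_pos_iff.2 hz.1
  have h := norm_iteratedDeriv_le_of_sector hε hball (hf.fun_sub (by fun_prop)) hQ hbd p hz
  rw [iteratedDeriv_sub_sum_range (Sector.isOpen hγ₂) hf a p p (Sector.mono hγ₁.le hz),
    Finset.sum_eq_zero fun j hj => by
      rw [Nat.descFactorial_eq_zero_iff_lt.2 (Finset.mem_range.1 hj)]; simp, sub_zero] at h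
  refine h.trans_eq ?_
  rw [div_pow, mul_pow, mul_pow]
  field_simp

theorem tendsto_iteratedDeriv_of_asymptotic {γ γ₁ ε : ℝ} (hγ₁ : γ < γ₁) (hγ₂ : γ₁ ≤ 2)
    (hε : 0 < ε) (hball : ∀ z ∈ Sector γ, Metric.closedBall z (ε * ‖z‖) ⊆ Sector γ₁)
    {f : ℂ → ℂ} (hf : DifferentiableOn ℂ f (Sector γ₁)) {a : ℕ → ℂ} {Q : ℝ} (hQ : 0 ≤ Q) {p : ℕ}
    (hbd : ∀ z ∈ Sector γ₁,
      ‖f z - ∑ j ∈ Finset.range (p + 1), a j * z ^ j‖ ≤ Q * ‖z‖ ^ (p + 1)) :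
    Tendsto (iteratedDeriv p f) (𝓝[Sector γ] 0) (𝓝 ((Nat.factorial p : ℂ) * a p)) := by
  rw [tendsto_iff_norm_sub_tendsto_zero]
  have hlim : Tendsto (fun z : ℂ => (Nat.factorial p : ℝ) * Q * (1 + ε) ^ (p + 1) / ε ^ p * ‖z‖)
      (𝓝[Sector γ] 0) (𝓝 0) := by
    have h0 : Tendsto (fun z : ℂ => (Nat.factorial p : ℝ) * Q * (1 + ε) ^ (p + 1) / ε ^ p * ‖z‖)
        (𝓝 0) (𝓝 ((Nat.factorial p : ℝ) * Q * (1 + ε) ^ (p + 1) / ε ^ p * ‖(0 : ℂ)‖)) :=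
      (continuous_const.mul continuous_norm).tendsto 0
    rw [norm_zero, mul_zero] at h0
    exact h0.mono_left nhdsWithin_le_nhds
  refine squeeze_zero' (Eventually.of_forall fun z => norm_nonneg _) ?_ hlim
  filter_upwards [self_mem_nhdsWithin] with z hz
  have hz0 : 0 < ‖z‖ := norm_pos_iff.2 hz.1
  have h := norm_iteratedDeriv_le_of_sector hε hball (hf.fun_sub (by fun_prop)) hQ hbd p hz
  rw [iteratedDeriv_sub_sum_range (Sector.isOpen hγ₂) hf a p (p + 1) (Sector.mono hγ₁.le hz),
    Finset.sum_range_succ, Finset.sum_eq_zero fun j hj => by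
      rw [Nat.descFactorial_eq_zero_iff_lt.2 (Finset.mem_range.1 hj)]; simp,
    Nat.descFactorial_self, Nat.sub_self, pow_zero, mul_one, zero_add, mul_comm (a p)] at h
  refine h.trans_eq ?_
  rw [mul_pow, mul_pow, pow_succ ‖z‖]
  field_simp

theorem exists_propertyP_of_lt_growthIndex {M : ℕ → ℝ} {γ : ℝ} (hγ0 : 0 < γ)
    (hγM : γ < growthIndex M) : ∃ γ' : ℝ, γ < γ' ∧ PropertyP M γ' := by
  have hne : {γ : ℝ | 0 < γ ∧ PropertyP M γ}.Nonempty := by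
    by_contra h
    rw [Set.not_nonempty_iff_eq_empty] at h
    rw [growthIndex, h, Real.sSup_empty] at hγM
    linarith
  obtain ⟨γ', hγ', hlt⟩ := exists_lt_of_lt_csSup hne hγM
  exact ⟨γ', hlt, hγ'.2⟩

theorem InLambda.exists_nonneg_bound {M : ℕ → ℝ} (hM0 : M 0 = 1) {σ : ℝ} {lam : ℕ → ℂ}
    (h : InLambda M σ lam) :
    ∃ C : ℝ, 0 ≤ C ∧ ∀ j : ℕ, ‖lam j‖ ≤ C * σ ^ j * (Nat.factorial j : ℝ) * M j := by
  obtain ⟨C, hC⟩ := h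
  have h0 := (norm_nonneg _).trans (hC 0)
  exact ⟨C, by simpa [hM0] using h0, hC⟩

/-- for strongly regular `M` and `0 < γ < min(γ(M), 2)` there is `d ≥ 1`
(depending only on `M` and `γ`) such that for every `σ > 0` there is a linear bounded
extension operator `T_{γ,σ} : Λ_{M,σ}(ℕ) → A_{M,dσ}(S_γ)` with `B(T_{γ,σ}λ) = λ`:
each `T_{γ,σ}λ` is holomorphic on `S_γ`, satisfies `|(T_{γ,σ}λ)^{(j)}(z)| ≤ K C (dσ)^j j! M_j`
whenever `|λ_j| ≤ C σ^j j! M_j`, and its `j`-th derivative tends to `λ_j` at `0` along `S_γ`. -/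
theorem stmt15 (M : ℕ → ℝ) (hM : StronglyRegular M) (γ : ℝ)
    (hγ0 : 0 < γ) (hγM : γ < growthIndex M) (hγ2 : γ < 2) :
    ∃ d : ℝ, 1 ≤ d ∧ ∀ σ : ℝ, 0 < σ →
      ∃ T : (ℕ → ℂ) → (ℂ → ℂ),
        (∀ lam μ : ℕ → ℂ, InLambda M σ lam → InLambda M σ μ →
          T (lam + μ) = T lam + T μ) ∧
        (∀ (c : ℂ) (lam : ℕ → ℂ), InLambda M σ lam → T (c • lam) = c • T lam) ∧
        (∃ K : ℝ, 0 < K ∧ ∀ (lam : ℕ → ℂ) (C : ℝ), 0 ≤ C →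
          (∀ j : ℕ, ‖lam j‖ ≤ C * σ ^ j * (Nat.factorial j : ℝ) * M j) →
          ∀ (j : ℕ), ∀ z ∈ Sector γ,
            ‖iteratedDerivWithin j (T lam) (Sector γ) z‖ ≤
              K * C * (d * σ) ^ j * (Nat.factorial j : ℝ) * M j) ∧
        (∀ lam : ℕ → ℂ, InLambda M σ lam →
          DifferentiableOn ℂ (T lam) (Sector γ) ∧
          ∀ j : ℕ, Filter.Tendsto (iteratedDerivWithin j (T lam) (Sector γ))
            (nhdsWithin 0 (Sector γ)) (nhds (lam j))) := by
  obtain ⟨γ', hγγ', hP⟩ := exists_propertyP_of_lt_growthIndex hγ0 hγM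
  obtain ⟨γ₁, hγ₁, hlt⟩ := exists_between (lt_min hγγ' hγ2)
  have hγ₁' : γ₁ < γ' := hlt.trans_le (min_le_left _ _)
  have hγ₂ : γ₁ ≤ 2 := (hlt.trans_le (min_le_right _ _)).le
  obtain ⟨X, H, d, hH, hd, hXd, hX⟩ :=
    exists_holomorphic_cutoffs hM (hγ0.trans hγ₁) hγ₂ hγ₁' hP
  obtain ⟨ε, hε, -, hball⟩ := Sector.exists_closedBall_subset hγ₁ hγ₂
  obtain ⟨A, hpos, hM0, -⟩ := hM
  have hεd : 1 ≤ (1 + ε) / ε := (one_le_div hε).2 (by linarith)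
  have hSo := Sector.isOpen hγ2.le
  refine ⟨d * ((1 + ε) / ε), one_le_mul_of_one_le_of_one_le hd hεd, fun σ hσ =>
    ⟨cutoffSeries γ₁ X σ, fun lam μ hlam hμ => ?_, fun c lam _ => ?_,
      ⟨2 * H + 1, by positivity, fun lam C hC hlam j z hz => ?_⟩,
      fun lam hlam => ?_⟩⟩
  · obtain ⟨C, hC, hlam⟩ := hlam.exists_nonneg_bound hM0
    obtain ⟨C', hC', hμ⟩ := hμ.exists_nonneg_bound hM0
    funext z
    by_cases hz : z ∈ Sector γ₁
    · simp only [cutoffSeries, Pi.add_apply, Set.indicator_of_mem hz, add_div, add_mul]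
      exact (summable_cutoffSeries hσ hX hC hlam hz).tsum_add
        (summable_cutoffSeries hσ hX hC' hμ hz)
    · simp only [cutoffSeries, Pi.add_apply, Set.indicator_of_notMem hz, add_zero]
  · funext z
    by_cases hz : z ∈ Sector γ₁
    · simp only [cutoffSeries, Pi.smul_apply, Set.indicator_of_mem hz, smul_eq_mul,
        mul_div_assoc, mul_assoc, tsum_mul_left]
    · simp only [cutoffSeries, Pi.smul_apply, Set.indicator_of_notMem hz, smul_zero]
  · rw [iteratedDerivWithin_of_isOpen hSo hz]
    have hMj := (hpos j).le
    have hd0 : 0 ≤ d := by linarith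
    refine (norm_iteratedDeriv_le_of_asymptotic hγ₁ hγ₂ hε hball
      (differentiableOn_cutoffSeries hγ₂ hσ hXd hX hC hlam)
      (show 0 ≤ 2 * H * C * (d * σ) ^ j * M j by positivity)
      (fun z hz => norm_cutoffSeries_sub_le hσ hX hC hlam hz j) hz).trans ?_
    calc
      _ = 2 * H * (C * (d * ((1 + ε) / ε) * σ) ^ j * (Nat.factorial j : ℝ) * M j) := by
        rw [show d * ((1 + ε) / ε) * σ = d * σ * ((1 + ε) / ε) by ring, mul_pow (d * σ)]
        ring
      _ ≤ (2 * H + 1) * (C * (d * ((1 + ε) / ε) * σ) ^ j * (Nat.factorial j : ℝ) * M j) := by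
        gcongr
        linarith
      _ = _ := by simp only [mul_assoc]
  · obtain ⟨C, hC, hlam⟩ := hlam.exists_nonneg_bound hM0
    have hdiff := differentiableOn_cutoffSeries hγ₂ hσ hXd hX hC hlam
    refine ⟨hdiff.mono (Sector.mono hγ₁.le), fun j => ?_⟩
    have hMj := (hpos (j + 1)).le
    have hd0 : 0 ≤ d := by linarith
    have h := tendsto_iteratedDeriv_of_asymptotic hγ₁ hγ₂ hε hball hdiff
      (show 0 ≤ 2 * H * C * (d * σ) ^ (j + 1) * M (j + 1) by positivity)
      (fun z hz => norm_cutoffSeries_sub_le hσ hX hC hlam hz (j + 1))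
    rw [mul_div_cancel₀ _ (by exact_mod_cast Nat.factorial_ne_zero j)] at h
    exact h.congr' (Filter.eventually_of_mem self_mem_nhdsWithin fun z hz =>
      (iteratedDerivWithin_of_isOpen hSo hz).symm)
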